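/- Canonical command sets A and B are refluent if and only if the following conditions hold: (a) if σ ∈ A and τ ∈ B are on the same node, then they have the same input value; (b) if σ, τ ∈ A ∪ B are on comparable nodes, then on every node strictly between their nodes there is a command of A ∪ B; (c) if σ, τ ∈ A ∪ B are on nodes parent(n) and n respectively, then: if one of the sets A, B has a command on n but none on parent(n), the input value of σ is D; and if one of the sets A, B has a command on parent(n) but none on n, the input value of τ is E. -/

import Mathlib

namespace FileSync

/-- A filesystem value: a directory, the empty value, or a file with content from `C`. -/
inductive Val (C : Type) : Type where
  | dir : Val C
  | empty : Val C
  | file : C → Val C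

/-- The type of a value, ordered E < F < D via 0 < 1 < 2. -/
def vtype {C : Type} : Val C → ℕ
  | Val.empty => 0
  | Val.file _ => 1
  | Val.dir => 2

/-- A node is a nonempty finite sequence of names. -/
abbrev Node (N : Type) : Type := { l : List N // l ≠ ([] : List N) }

/-- `Anc m n`: `m` is a proper ancestor of (strictly above) `n`. -/
def Anc {N : Type} (m n : Node N) : Prop := m.1 <+: n.1 ∧ m ≠ n

/-- Two nodes are comparable if one is a prefix of the other. -/
def NodesComparable {N : Type} (m n : Node N) : Prop := m.1 <+: n.1 ∨ n.1 <+: m.1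

/-- `IsParent p n`: `p` is the parent of `n` (removing the last name of `n` gives `p`). -/
def IsParent {N : Type} (p n : Node N) : Prop := ∃ a : N, n.1 = p.1 ++ [a]

/-- A command: a node, an input value (precondition) and an output value. -/
structure Cmd (N C : Type) where
  node : Node N
  inp : Val C
  out : Val C

variable {N C : Type} [DecidableEq N]

/-- A valid filesystem: finitely many non-empty nodes, and the tree property. -/
def ValidFS (f : Node N → Val C) : Prop :=
  {n : Node N | f n ≠ Val.empty}.Finite ∧
  ∀ n m : Node N, Anc m n → f n ≠ Val.empty → f m = Val.dir

/-- Replace the value at the node of `σ` by its output value. -/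
def upd (f : Node N → Val C) (σ : Cmd N C) : Node N → Val C :=
  fun m => if m = σ.node then σ.out else f m

/-- `SeqOK α f`: the command sequence `α` does not break the filesystem `f`:
each command finds its input value and yields a valid filesystem. -/
def SeqOK : List (Cmd N C) → (Node N → Val C) → Prop
  | [], _ => True
  | σ :: rest, f => f σ.node = σ.inp ∧ ValidFS (upd f σ) ∧ SeqOK rest (upd f σ)

/-- The result of applying a command sequence (left to right). -/
def applySeq : List (Cmd N C) → (Node N → Val C) → (Node N → Val C)
  | [], f => f
  | σ :: rest, f => applySeq rest (upd f σ)

/-- A sequence is non-breaking if there is at least one filesystem it does not break. -/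
def NonBreaking (α : List (Cmd N C)) : Prop := ∃ f, ValidFS f ∧ SeqOK α f

/-- Semantic equivalence: on every filesystem both break, or both yield the same result. -/
def SeqEquiv (α β : List (Cmd N C)) : Prop :=
  ∀ f, ValidFS f → ((SeqOK α f ↔ SeqOK β f) ∧ (SeqOK α f → applySeq α f = applySeq β f))

/-- `SeqExt α β`: `β` semantically extends `α` (`α ≤ β`). -/
def SeqExt (α β : List (Cmd N C)) : Prop :=
  ∀ f, ValidFS f → SeqOK α f → SeqOK β f ∧ applySeq β f = applySeq α f

/-- The `≪` relation between commands on child–parent or parent–child nodes. -/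
def LL (σ τ : Cmd N C) : Prop :=
  (IsParent τ.node σ.node ∧ σ.out = Val.empty ∧ σ.inp ≠ Val.empty ∧
      τ.inp = Val.dir ∧ τ.out ≠ Val.dir) ∨
  (IsParent σ.node τ.node ∧ σ.out = Val.dir ∧ σ.inp ≠ Val.dir ∧
      τ.inp = Val.empty ∧ τ.out ≠ Val.empty)

/-- A canonical command set: finite, no null commands, at most one command per node,
`≪`-connected (commands on distinct comparable nodes are joined by a `≪`-chain in the set). -/
def Canonical (A : Set (Cmd N C)) : Prop :=
  A.Finite ∧
  (∀ σ ∈ A, σ.inp ≠ σ.out) ∧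
  (∀ σ ∈ A, ∀ τ ∈ A, σ.node = τ.node → σ = τ) ∧
  (∀ σ ∈ A, ∀ τ ∈ A, σ.node ≠ τ.node → NodesComparable σ.node τ.node →
    Relation.ReflTransGen (fun a b => a ∈ A ∧ b ∈ A ∧ LL a b) σ τ ∨
    Relation.ReflTransGen (fun a b => a ∈ A ∧ b ∈ A ∧ LL a b) τ σ)

/-- A sequence honors `≪`: whenever `σ ≪ τ` for members, `σ` precedes `τ`. -/
def Honors (α : List (Cmd N C)) : Prop :=
  ∀ σ ∈ α, ∀ τ ∈ α, LL σ τ → List.Sublist [σ, τ] α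

/-- A canonical sequence: its commands form a canonical set and it honors `≪`. -/
def CanonicalSeq (α : List (Cmd N C)) : Prop :=
  α.Nodup ∧ Canonical {σ : Cmd N C | σ ∈ α} ∧ Honors α

/-- `Orders A α`: the sequence `α` is an arrangement of the set `A` honoring `≪`. -/
def Orders (A : Set (Cmd N C)) (α : List (Cmd N C)) : Prop :=
  α.Nodup ∧ (∀ σ : Cmd N C, σ ∈ α ↔ σ ∈ A) ∧ Honors α

/-- The action of a canonical set: `A` does not break `f`
(some `≪`-honoring arrangement exists, and every such arrangement works on `f`). -/
def SetNoBreak (A : Set (Cmd N C)) (f : Node N → Val C) : Prop :=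
  (∃ α, Orders A α) ∧ ∀ α, Orders A α → SeqOK α f

/-- `SetApp A f g`: applying the set `A` (in any `≪`-honoring order) to `f` yields `g`. -/
def SetApp (A : Set (Cmd N C)) (f g : Node N → Val C) : Prop :=
  SetNoBreak A f ∧ ∀ α, Orders A α → applySeq α f = g

/-- The set `S` has a command on node `n`. -/
def Mentions (S : Set (Cmd N C)) (n : Node N) : Prop := ∃ ρ ∈ S, ρ.node = n

/-- Two canonical sets are refluent if some filesystem is broken by neither. -/
def Refluent (A B : Set (Cmd N C)) : Prop :=
  ∃ f, ValidFS f ∧ SetNoBreak A f ∧ SetNoBreak B f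

/-- Canonical sets are jointly refluent if a single filesystem is broken by none of them. -/
def JointlyRefluent {k : ℕ} (A : Fin k → Set (Cmd N C)) : Prop :=
  ∃ f, ValidFS f ∧ ∀ i, SetNoBreak (A i) f

/-- Two distinct commands are in conflict if they are on the same node, or one is on a
proper ancestor node, creates a non-directory, and the lower one creates non-empty content. -/
def Conflict (σ τ : Cmd N C) : Prop :=
  σ ≠ τ ∧ (σ.node = τ.node ∨
    (Anc σ.node τ.node ∧ σ.out ≠ Val.dir ∧ τ.out ≠ Val.empty) ∨
    (Anc τ.node σ.node ∧ τ.out ≠ Val.dir ∧ σ.out ≠ Val.empty))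

/-- A merger: a maximal canonical subset of `⋃ i, A i`. -/
def Merger {k : ℕ} (A : Fin k → Set (Cmd N C)) (M : Set (Cmd N C)) : Prop :=
  M ⊆ (⋃ i, A i) ∧ Canonical M ∧
  ∀ M' : Set (Cmd N C), M ⊆ M' → M' ⊆ (⋃ i, A i) → Canonical M' → M' = M

/-- `B` is an initial segment of `A`: there is an `≪`-honoring arrangement of `A` in which
all commands of `B` precede all commands of `A \ B`. -/
def InitSeg (B A : Set (Cmd N C)) : Prop :=
  B ⊆ A ∧ ∃ α₁ α₂ : List (Cmd N C), Orders B α₁ ∧ Orders (A \ B) α₂ ∧ Orders A (α₁ ++ α₂)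

/-- The inverse of a command. -/
def cinv (σ : Cmd N C) : Cmd N C := ⟨σ.node, σ.out, σ.inp⟩

/-- The inverse of a sequence: inverses of its commands in reverse order. -/
def seqInv (α : List (Cmd N C)) : List (Cmd N C) := (α.map cinv).reverse

theorem IsParent.len {p n : Node N} (h : IsParent p n) : n.1.length = p.1.length + 1 := by
  obtain ⟨a, h⟩ := h
  simp [h]

theorem IsParent.ne {p n : Node N} (h : IsParent p n) : p ≠ n := by
  intro e
  have := h.len
  rw [e] at this
  omega

theorem IsParent.anc {p n : Node N} (h : IsParent p n) : Anc p n := by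
  refine ⟨?_, h.ne⟩
  obtain ⟨a, h⟩ := h
  exact ⟨[a], h.symm⟩

theorem Anc.trans' {a b c : Node N} (h : Anc a b) (h' : Anc b c) : Anc a c := by
  refine ⟨h.1.trans h'.1, ?_⟩
  rintro rfl
  exact h.2 (Subtype.ext (h.1.eq_of_length_le h'.1.length_le))

theorem anc_parent {m n : Node N} (h : Anc m n) :
    ∃ p : Node N, IsParent p n ∧ (m = p ∨ Anc m p) := by
  obtain ⟨⟨t, ht⟩, hne⟩ := h
  rcases List.eq_nil_or_concat t with rfl | ⟨s, a, rfl⟩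
  · exact absurd (Subtype.ext (by simpa using ht)) hne
  · refine ⟨⟨m.1 ++ s, by simp [m.2]⟩, ⟨a, by simp [← ht]⟩, ?_⟩
    by_cases e : m = ⟨m.1 ++ s, by simp [m.2]⟩
    · exact Or.inl e
    · exact Or.inr ⟨⟨s, rfl⟩, e⟩

theorem anc_child {m n : Node N} (h : Anc m n) :
    ∃ c : Node N, IsParent m c ∧ (c = n ∨ Anc c n) := by
  obtain ⟨⟨t, ht⟩, hne⟩ := h
  rcases t with _ | ⟨a, s⟩
  · exact absurd (Subtype.ext (by simpa using ht)) hne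
  · refine ⟨⟨m.1 ++ [a], by simp⟩, ⟨a, rfl⟩, ?_⟩
    by_cases e : (⟨m.1 ++ [a], by simp⟩ : Node N) = n
    · exact Or.inl e
    · exact Or.inr ⟨⟨s, by simp [← ht]⟩, e⟩

/-- The local conditions equivalent to not breaking `f`. -/
def LocOK (A : Set (Cmd N C)) (f : Node N → Val C) : Prop :=
  (∀ σ ∈ A, f σ.node = σ.inp) ∧
  (∀ σ ∈ A, ∀ p, IsParent p σ.node → ¬ Mentions A p → f p = Val.dir) ∧
  (∀ σ ∈ A, ∀ n, IsParent σ.node n → ¬ Mentions A n → f n = Val.empty)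

theorem chain_mono {A : Set (Cmd N C)} {a b : Cmd N C}
    (h : Relation.ReflTransGen (fun a b => a ∈ A ∧ b ∈ A ∧ LL a b) a b) :
    a = b ∨
    (a.out = Val.dir ∧ a.inp ≠ Val.dir ∧ b.inp = Val.empty ∧ b.out ≠ Val.empty ∧
      a.node.1.length < b.node.1.length) ∨
    (a.out = Val.empty ∧ a.inp ≠ Val.empty ∧ b.inp = Val.dir ∧ b.out ≠ Val.dir ∧
      b.node.1.length < a.node.1.length) := by
  induction h with
  | refl => exact Or.inl rfl
  | tail _ hbc ih =>
    obtain ⟨-, -, hl⟩ := hbc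
    rcases hl with ⟨hp, h1, h2, h3, h4⟩ | ⟨hp, h1, h2, h3, h4⟩
    · have := hp.len
      rcases ih with rfl | ⟨i1, i2, i3, i4, i5⟩ | ⟨i1, i2, i3, i4, i5⟩
      · exact Or.inr (Or.inr ⟨h1, h2, h3, h4, by omega⟩)
      · exact absurd i3 h2
      · exact Or.inr (Or.inr ⟨i1, i2, h3, h4, by omega⟩)
    · have := hp.len
      rcases ih with rfl | ⟨i1, i2, i3, i4, i5⟩ | ⟨i1, i2, i3, i4, i5⟩
      · exact Or.inr (Or.inl ⟨h1, h2, h3, h4, by omega⟩)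
      · exact Or.inr (Or.inl ⟨i1, i2, h3, h4, by omega⟩)
      · exact absurd i3 h2

theorem Canonical.adj {A : Set (Cmd N C)} (hA : Canonical A) {σ τ : Cmd N C}
    (hσ : σ ∈ A) (hτ : τ ∈ A) (hp : IsParent σ.node τ.node) :
    (σ.out = Val.dir ∧ τ.inp = Val.empty ∧ LL σ τ) ∨
    (σ.inp = Val.dir ∧ τ.out = Val.empty ∧ LL τ σ) := by
  have hl := hp.len
  rcases hA.2.2.2 σ hσ τ hτ hp.ne (Or.inl hp.anc.1) with h | h
  · rcases chain_mono h with rfl | ⟨i1, i2, i3, i4, i5⟩ | ⟨i1, i2, i3, i4, i5⟩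
    · exact absurd rfl hp.ne
    · exact Or.inl ⟨i1, i3, Or.inr ⟨hp, i1, i2, i3, i4⟩⟩
    · omega
  · rcases chain_mono h with rfl | ⟨i1, i2, i3, i4, i5⟩ | ⟨i1, i2, i3, i4, i5⟩
    · exact absurd rfl hp.ne
    · omega
    · exact Or.inr ⟨i3, i1, Or.inl ⟨hp, i1, i2, i3, i4⟩⟩

theorem mem_pre_of_sublist {α : Type} {s t : α} {suf : List α} :
    ∀ {pre : List α}, (pre ++ s :: suf).Nodup → List.Sublist [t, s] (pre ++ s :: suf) → t ∈ pre
  | [], hn, hs => by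
    exfalso
    simp only [List.nil_append, List.nodup_cons] at hn hs
    cases hs with
    | cons _ h => exact hn.1 (h.subset (by simp))
    | cons_cons _ h => exact hn.1 (h.subset (by simp))
  | a :: pre, hn, hs => by
    simp only [List.cons_append, List.nodup_cons] at hn hs
    cases hs with
    | cons _ h => exact List.mem_cons_of_mem _ (mem_pre_of_sublist hn.2 h)
    | cons_cons _ h => exact List.mem_cons_self

theorem validFS_upd {g : Node N → Val C} {σ : Cmd N C} (hg : ValidFS g)
    (hi : g σ.node = σ.inp)
    (h1 : σ.inp = Val.empty → ∀ p, IsParent p σ.node → g p = Val.dir)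
    (h2 : σ.inp = Val.dir → ∀ n, IsParent σ.node n → g n = Val.empty) :
    ValidFS (upd g σ) := by
  constructor
  · refine (hg.1.union (Set.finite_singleton σ.node)).subset ?_
    intro n hn
    by_cases e : n = σ.node
    · exact Or.inr e
    · left
      simpa [upd, e] using hn
  · intro n m hmn hn
    by_cases e : n = σ.node
    · subst e
      have hm : g m = Val.dir := by
        by_cases hx : σ.inp = Val.empty
        · obtain ⟨p, hp, hmp⟩ := anc_parent hmn
          have hd := h1 hx p hp
          rcases hmp with rfl | hmp
          · exact hd
          · exact hg.2 p m hmp (by simp [hd])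
        · exact hg.2 _ m hmn (by rwa [hi])
      simpa [upd, hmn.2] using hm
    · have hn' : g n ≠ Val.empty := by simpa [upd, e] using hn
      have hm := hg.2 n m hmn hn'
      by_cases e' : m = σ.node
      · exfalso
        subst e'
        obtain ⟨c, hc, hcn⟩ := anc_child hmn
        have hce := h2 (by rw [← hi, hm]) c hc
        rcases hcn with rfl | hcn
        · exact hn' hce
        · have := hg.2 n c hcn hn'
          simp [hce] at this
      · simpa [upd, e'] using hm

theorem seqOK_aux {A : Set (Cmd N C)} (hA : Canonical A) {f : Node N → Val C}
    (hl : LocOK A f) : ∀ (suf pre : List (Cmd N C)) (g : Node N → Val C),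
    Orders A (pre ++ suf) → ValidFS g →
    (∀ σ ∈ pre, g σ.node = σ.out) →
    (∀ n, (∀ σ ∈ pre, σ.node ≠ n) → g n = f n) → SeqOK suf g := by
  intro suf
  induction suf with
  | nil => intros; trivial
  | cons σ suf ih =>
    intro pre g ho hg hp hf
    obtain ⟨hnd, hmem, hhon⟩ := ho
    have hσ : σ ∈ A := (hmem σ).1 (by simp)
    have hpre : ∀ ρ ∈ pre, ρ ∈ A := fun ρ h => (hmem ρ).1 (by simp [h])
    have hnp : ∀ ρ ∈ pre, ρ.node ≠ σ.node := by
      intro ρ hρ e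
      have := hA.2.2.1 ρ (hpre ρ hρ) σ hσ e
      subst this
      rw [List.nodup_append] at hnd
      exact hnd.2.2 ρ hρ ρ (by simp) rfl
    have hi : g σ.node = σ.inp := by rw [hf _ hnp, hl.1 σ hσ]
    have hprec : ∀ τ ∈ A, LL τ σ → τ ∈ pre := by
      intro τ hτ h
      exact mem_pre_of_sublist hnd (hhon τ ((hmem τ).2 hτ) σ ((hmem σ).2 hσ) h)
    have hv : ValidFS (upd g σ) := by
      refine validFS_upd hg hi ?_ ?_
      · intro hx p hpar
        by_cases hm : Mentions A p
        · obtain ⟨τ, hτ, rfl⟩ := hm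
          rcases hA.adj hτ hσ hpar with ⟨h1, _, h3⟩ | ⟨h1, h2, h3⟩
          · rw [hp τ (hprec τ hτ h3), h1]
          · exact absurd (hx.trans h2.symm) (hA.2.1 σ hσ)
        · rw [hf p (fun ρ hρ e => hm ⟨ρ, hpre ρ hρ, e⟩)]
          exact hl.2.1 σ hσ p hpar hm
      · intro hx n hpar
        by_cases hm : Mentions A n
        · obtain ⟨τ, hτ, rfl⟩ := hm
          rcases hA.adj hσ hτ hpar with ⟨h1, _, h3⟩ | ⟨h1, h2, h3⟩
          · exact absurd (hx.trans h1.symm) (hA.2.1 σ hσ)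
          · rw [hp τ (hprec τ hτ h3), h2]
        · rw [hf n (fun ρ hρ e => hm ⟨ρ, hpre ρ hρ, e⟩)]
          exact hl.2.2 σ hσ n hpar hm
    refine ⟨hi, hv, ih (pre ++ [σ]) (upd g σ) ?_ hv ?_ ?_⟩
    · rw [List.append_assoc, List.singleton_append]
      exact ⟨hnd, hmem, hhon⟩
    · intro ρ hρ
      rcases List.mem_append.1 hρ with h | h
      · simp [upd, hnp ρ h, hp ρ h]
      · simp at h
        subst h
        simp [upd]
    · intro n hn
      have h1 : σ.node ≠ n := hn σ (by simp)
      have h2 := hf n (fun ρ hρ => hn ρ (by simp [hρ]))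
      simp [upd, h1.symm, h2]

open Classical in
/-- A rank increasing along the relation `LL`. -/
noncomputable def rank (σ : Cmd N C) : ℤ :=
  if σ.inp = Val.empty ∨ σ.out = Val.dir then (σ.node.1.length : ℤ) else -(σ.node.1.length : ℤ)

theorem rank_lt {σ τ : Cmd N C} (h : LL σ τ) : rank σ < rank τ := by
  rcases h with ⟨hp, h1, h2, h3, h4⟩ | ⟨hp, h1, h2, h3, h4⟩
  · have := hp.len
    simp [rank, h1, h2, h3, h4]
    omega
  · have := hp.len
    simp [rank, h1, h3]
    omega

theorem sublist_of_rank {σ τ : Cmd N C} (h : rank σ < rank τ) :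
    ∀ {α : List (Cmd N C)}, α.Pairwise (fun a b => rank a ≤ rank b) → σ ∈ α → τ ∈ α →
      List.Sublist [σ, τ] α
  | [], _, hs, _ => by simp at hs
  | a :: α, hp, hs, ht => by
    rw [List.pairwise_cons] at hp
    rcases List.mem_cons.1 hs with rfl | hs'
    · rcases List.mem_cons.1 ht with rfl | ht'
      · exact absurd h (lt_irrefl _)
      · exact List.Sublist.cons_cons _ (List.singleton_sublist.2 ht')
    · rcases List.mem_cons.1 ht with rfl | ht'
      · exact absurd h (not_lt.2 (hp.1 _ hs'))
      · exact List.Sublist.cons _ (sublist_of_rank h hp.2 hs' ht')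

theorem exists_orders {A : Set (Cmd N C)} (hA : A.Finite) : ∃ α, Orders A α := by
  classical
  let l := hA.toFinset.toList.mergeSort (fun a b => decide (rank a ≤ rank b))
  have hperm : l.Perm hA.toFinset.toList := List.mergeSort_perm _ _
  have hs : l.Pairwise (fun a b => rank a ≤ rank b) := by
    have := List.pairwise_mergeSort (le := fun a b : Cmd N C => decide (rank a ≤ rank b))
      (by simp; intro a b c; exact le_trans) (by simp; intro a b; exact le_total _ _)
      hA.toFinset.toList
    simpa using this
  refine ⟨l, hperm.nodup_iff.2 (Finset.nodup_toList _), ?_, ?_⟩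
  · intro σ
    rw [hperm.mem_iff]
    simp
  · intro σ hσ τ hτ h
    exact sublist_of_rank (rank_lt h) hs hσ hτ

theorem seqOK_inp : ∀ {α : List (Cmd N C)} {f : Node N → Val C}, α.Nodup →
    (∀ σ ∈ α, ∀ τ ∈ α, σ.node = τ.node → σ = τ) → SeqOK α f → ∀ σ ∈ α, f σ.node = σ.inp
  | [], _, _, _, _, σ, hσ => by simp at hσ
  | a :: α, f, hn, hu, hok, σ, hσ => by
    rw [List.nodup_cons] at hn
    rcases List.mem_cons.1 hσ with rfl | h
    · exact hok.1
    · have := seqOK_inp hn.2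
        (fun x hx y hy => hu x (List.mem_cons_of_mem _ hx) y (List.mem_cons_of_mem _ hy))
        hok.2.2 σ h
      have hne : σ.node ≠ a.node := by
        intro e
        have := hu σ hσ a List.mem_cons_self e
        subst this
        exact hn.1 h
      simpa [upd, hne] using this

theorem seqOK_par : ∀ {α : List (Cmd N C)} {f : Node N → Val C}, ValidFS f → SeqOK α f →
    ∀ σ ∈ α, σ.inp ≠ σ.out → ∀ p, IsParent p σ.node → (∀ ρ ∈ α, ρ.node ≠ p) → f p = Val.dir
  | [], _, _, _, σ, hσ => by simp at hσ
  | a :: α, f, hv, hok, σ, hσ => by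
    intro hne p hp hnm
    have hpa : p ≠ a.node := (hnm a List.mem_cons_self).symm
    rcases List.mem_cons.1 hσ with rfl | h
    · by_cases hx : σ.inp = Val.empty
      · have := hok.2.1.2 σ.node p hp.anc (by simp only [upd, if_true]; rw [← hx]; exact hne.symm)
        simpa [upd, hpa] using this
      · exact hv.2 σ.node p hp.anc (by rwa [hok.1])
    · have := seqOK_par hok.2.1 hok.2.2 σ h hne p hp
        (fun ρ hρ => hnm ρ (List.mem_cons_of_mem _ hρ))
      simpa [upd, hpa] using this

theorem seqOK_child : ∀ {α : List (Cmd N C)} {f : Node N → Val C}, ValidFS f → SeqOK α f →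
    ∀ σ ∈ α, σ.inp ≠ σ.out → ∀ n, IsParent σ.node n → (∀ ρ ∈ α, ρ.node ≠ n) → f n = Val.empty
  | [], _, _, _, σ, hσ => by simp at hσ
  | a :: α, f, hv, hok, σ, hσ => by
    intro hne n hp hnm
    have hpa : n ≠ a.node := (hnm a List.mem_cons_self).symm
    rcases List.mem_cons.1 hσ with rfl | h
    · by_contra hc
      have h1 := hv.2 n σ.node hp.anc hc
      have h2 := hok.2.1.2 n σ.node hp.anc (by simpa [upd, hpa] using hc)
      simp only [upd, if_true] at h2
      exact hne (by rw [← hok.1, h1, h2])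
    · have := seqOK_child hok.2.1 hok.2.2 σ h hne n hp
        (fun ρ hρ => hnm ρ (List.mem_cons_of_mem _ hρ))
      simpa [upd, hpa] using this

theorem setNoBreak_iff {A : Set (Cmd N C)} (hA : Canonical A) {f : Node N → Val C}
    (hf : ValidFS f) : SetNoBreak A f ↔ LocOK A f := by
  constructor
  · rintro ⟨⟨α, ho⟩, h⟩
    have hok := h α ho
    obtain ⟨hnd, hmem, -⟩ := ho
    refine ⟨fun σ hσ => ?_, fun σ hσ p hp hm => ?_, fun σ hσ p hp hm => ?_⟩
    · exact seqOK_inp hnd (fun x hx y hy => hA.2.2.1 x ((hmem x).1 hx) y ((hmem y).1 hy)) hok σ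
        ((hmem σ).2 hσ)
    · exact seqOK_par hf hok σ ((hmem σ).2 hσ) (hA.2.1 σ hσ) p hp
        (fun ρ hρ e => hm ⟨ρ, (hmem ρ).1 hρ, e⟩)
    · exact seqOK_child hf hok σ ((hmem σ).2 hσ) (hA.2.1 σ hσ) p hp
        (fun ρ hρ e => hm ⟨ρ, (hmem ρ).1 hρ, e⟩)
  · intro hl
    refine ⟨exists_orders hA.1, fun α ho => ?_⟩
    exact seqOK_aux hA hl α [] f (by simpa using ho) hf (by simp) (by simp)

theorem LocOK.below {A : Set (Cmd N C)} {f : Node N → Val C} (hf : ValidFS f)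
    (hl : LocOK A f) {σ : Cmd N C} (hσ : σ ∈ A) : ∀ (k : ℕ) (n : Node N), n.1.length = k →
      Anc σ.node n → ¬ Mentions A n → f n = Val.empty := by
  intro k
  induction k with
  | zero => 
    intro n hn
    exact absurd (List.length_eq_zero_iff.1 hn) n.2
  | succ k ih =>
    intro n hn ha hm
    obtain ⟨p, hp, hsp⟩ := anc_parent ha
    by_cases hmp : Mentions A p
    · obtain ⟨ρ, hρ, rfl⟩ := hmp
      exact hl.2.2 ρ hρ n hp hm
    · have hlen := hp.len
      rcases hsp with e | hsp
      · exact absurd ⟨σ, hσ, e⟩ hmp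
      · have he := ih p (by omega) hsp hmp
        by_contra hc
        have := hf.2 n p hp.anc hc
        simp [he] at this

theorem LocOK.above {A : Set (Cmd N C)} {f : Node N → Val C} (hf : ValidFS f)
    (hl : LocOK A f) {τ : Cmd N C} (hτ : τ ∈ A) : ∀ (k : ℕ) (n : Node N),
      τ.node.1.length = n.1.length + k →
      Anc n τ.node → ¬ Mentions A n → f n = Val.dir := by
  intro k
  induction k with
  | zero => 
    intro n hn ha
    exact absurd (Subtype.ext (ha.1.eq_of_length (by omega))) ha.2
  | succ k ih =>
    intro n hn ha hm
    obtain ⟨c, hc, hct⟩ := anc_child ha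
    by_cases hmc : Mentions A c
    · obtain ⟨ρ, hρ, rfl⟩ := hmc
      exact hl.2.1 ρ hρ n hc hm
    · have hlen := hc.len
      rcases hct with e | hct
      · exact absurd ⟨τ, hτ, e.symm⟩ hmc
      · have he := ih c (by omega) hct hmc
        exact hf.2 c n hc.anc (by simp [he])

theorem LocOK.below' {A : Set (Cmd N C)} {f : Node N → Val C} (hf : ValidFS f)
    (hl : LocOK A f) {σ : Cmd N C} (hσ : σ ∈ A) {n : Node N}
    (ha : Anc σ.node n) (hm : ¬ Mentions A n) : f n = Val.empty :=
  hl.below hf hσ _ n rfl ha hm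

theorem LocOK.above' {A : Set (Cmd N C)} {f : Node N → Val C} (hf : ValidFS f)
    (hl : LocOK A f) {τ : Cmd N C} (hτ : τ ∈ A) {n : Node N}
    (ha : Anc n τ.node) (hm : ¬ Mentions A n) : f n = Val.dir :=
  hl.above hf hτ (τ.node.1.length - n.1.length) n
    (by have := ha.1.length_le; omega) ha hm

theorem finite_prefixes (m : Node N) : {n : Node N | n.1 <+: m.1}.Finite := by
  refine Set.Finite.of_finite_image (f := Subtype.val) ?_ Subtype.val_injective.injOn
  refine (List.finite_toSet m.1.inits).subset ?_
  rintro _ ⟨n, hn, rfl⟩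
  simpa using hn

open Classical in
/-- The filesystem witnessing refluence. -/
noncomputable def witness (S : Set (Cmd N C)) (n : Node N) : Val C :=
  if h : Mentions S n then h.choose.inp
  else if ∃ τ ∈ S, Anc n τ.node then Val.dir else Val.empty

/-- Characterization of refluent canonical sets `A`, `B` by conditions
(a) equal inputs on shared nodes, (b) no gaps between comparable nodes,
(c) input D above an unshared child command / input E below an unshared parent command. -/
theorem stmt_6 {N C : Type} [DecidableEq N] (A B : Set (Cmd N C))
    (hA : Canonical A) (hB : Canonical B) :
    Refluent A B ↔
      ((∀ σ ∈ A, ∀ τ ∈ B, σ.node = τ.node → σ.inp = τ.inp) ∧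
       (∀ σ ∈ A ∪ B, ∀ τ ∈ A ∪ B, ∀ n' : Node N,
          Anc σ.node n' → Anc n' τ.node → Mentions (A ∪ B) n') ∧
       (∀ σ ∈ A ∪ B, ∀ τ ∈ A ∪ B, IsParent σ.node τ.node →
          ((((Mentions A τ.node ∧ ¬ Mentions A σ.node) ∨
             (Mentions B τ.node ∧ ¬ Mentions B σ.node)) → σ.inp = Val.dir) ∧
           (((Mentions A σ.node ∧ ¬ Mentions A τ.node) ∨
             (Mentions B σ.node ∧ ¬ Mentions B τ.node)) → τ.inp = Val.empty)))) := by
  constructor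
  · rintro ⟨f, hf, hnA, hnB⟩
    have lA := (setNoBreak_iff hA hf).1 hnA
    have lB := (setNoBreak_iff hB hf).1 hnB
    have hinp : ∀ σ ∈ A ∪ B, f σ.node = σ.inp := by
      rintro σ (h | h)
      exacts [lA.1 σ h, lB.1 σ h]
    refine ⟨?_, ?_, ?_⟩
    · intro σ hσ τ hτ e
      rw [← lA.1 σ hσ, ← lB.1 τ hτ, e]
    · intro σ hσ τ hτ n h1 h2
      by_contra hm
      have mA : ¬ Mentions A n := fun ⟨ρ, h, e⟩ => hm ⟨ρ, Or.inl h, e⟩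
      have mB : ¬ Mentions B n := fun ⟨ρ, h, e⟩ => hm ⟨ρ, Or.inr h, e⟩
      have e1 : f n = Val.empty := by
        rcases hσ with h | h
        exacts [lA.below' hf h h1 mA, lB.below' hf h h1 mB]
      have e2 : f n = Val.dir := by
        rcases hτ with h | h
        exacts [lA.above' hf h h2 mA, lB.above' hf h h2 mB]
      simp [e1] at e2
    · intro σ hσ τ hτ hp
      rw [← hinp σ hσ, ← hinp τ hτ]
      constructor
      · rintro (⟨⟨ρ, hρ, e⟩, hm⟩ | ⟨⟨ρ, hρ, e⟩, hm⟩)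
        · exact lA.2.1 ρ hρ _ (by rwa [e]) hm
        · exact lB.2.1 ρ hρ _ (by rwa [e]) hm
      · rintro (⟨⟨ρ, hρ, e⟩, hm⟩ | ⟨⟨ρ, hρ, e⟩, hm⟩)
        · exact lA.2.2 ρ hρ _ (by rwa [e]) hm
        · exact lB.2.2 ρ hρ _ (by rwa [e]) hm
  · rintro ⟨ha, hb, hc⟩
    have hinp : ∀ σ ∈ A ∪ B, ∀ τ ∈ A ∪ B, σ.node = τ.node → σ.inp = τ.inp := by
      rintro σ (h | h) τ (h' | h') e
      · rw [hA.2.2.1 σ h τ h' e]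
      · exact ha σ h τ h' e
      · exact (ha τ h' σ h e.symm).symm
      · rw [hB.2.2.1 σ h τ h' e]
    have w1 : ∀ σ ∈ A ∪ B, witness (A ∪ B) σ.node = σ.inp := by
      intro σ hσ
      have hm : Mentions (A ∪ B) σ.node := ⟨σ, hσ, rfl⟩
      rw [witness, dif_pos hm]
      exact hinp _ hm.choose_spec.1 σ hσ hm.choose_spec.2
    have w2 : ∀ n, ¬ Mentions (A ∪ B) n → ∀ τ ∈ A ∪ B, Anc n τ.node →
        witness (A ∪ B) n = Val.dir := by
      intro n hm τ hτ h
      rw [witness, dif_neg hm, if_pos ⟨τ, hτ, h⟩]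
    have w3 : ∀ n, ¬ Mentions (A ∪ B) n → (¬ ∃ τ ∈ A ∪ B, Anc n τ.node) →
        witness (A ∪ B) n = Val.empty := by
      intro n hm h
      rw [witness, dif_neg hm, if_neg h]
    have adj : ∀ σ ∈ A ∪ B, ∀ τ ∈ A ∪ B, IsParent σ.node τ.node → τ.inp ≠ Val.empty →
        σ.inp = Val.dir := by
      intro σ hσ τ hτ hp hne
      have key : ∀ S : Set (Cmd N C), Canonical S → S ⊆ A ∪ B → τ ∈ S → 
          Mentions S σ.node → σ.inp = Val.dir := by
        rintro S hS hsub hτS ⟨ρ, hρ, e⟩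
        rcases hS.adj hρ hτS (by rwa [e]) with ⟨_, h, _⟩ | ⟨h, _, _⟩
        · exact absurd h hne
        · rw [← hinp ρ (hsub hρ) σ hσ e, h]
      rcases hτ with h | h
      · by_cases hm : Mentions A σ.node
        · exact key A hA Set.subset_union_left h hm
        · exact (hc σ hσ τ (Or.inl h) hp).1 (Or.inl ⟨⟨τ, h, rfl⟩, hm⟩)
      · by_cases hm : Mentions B σ.node
        · exact key B hB Set.subset_union_right h hm
        · exact (hc σ hσ τ (Or.inr h) hp).1 (Or.inr ⟨⟨τ, h, rfl⟩, hm⟩)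
    have hne : ∀ n, witness (A ∪ B) n ≠ Val.empty → 
        Mentions (A ∪ B) n ∨ ∃ τ ∈ A ∪ B, Anc n τ.node := by
      intro n hn
      by_contra hcon
      rw [not_or] at hcon
      exact hn (w3 n hcon.1 hcon.2)
    -- one step of the tree property
    have step : ∀ n p, IsParent p n → witness (A ∪ B) n ≠ Val.empty →
        witness (A ∪ B) p = Val.dir := by
      intro n p hp hn
      by_cases hm : Mentions (A ∪ B) p
      · obtain ⟨σ, hσ, rfl⟩ := hm
        have hmn : Mentions (A ∪ B) n := by
          rcases hne n hn with h | ⟨τ, hτ, h⟩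
          · exact h
          · exact hb σ hσ τ hτ n hp.anc h
        obtain ⟨τ, hτ, rfl⟩ := hmn
        rw [w1 τ hτ] at hn
        rw [w1 σ hσ]
        exact adj σ hσ τ hτ hp hn
      · rcases hne n hn with ⟨τ, hτ, rfl⟩ | ⟨τ, hτ, h⟩
        · exact w2 p hm τ hτ hp.anc
        · exact w2 p hm τ hτ (hp.anc.trans' h)
    have hv : ValidFS (witness (A ∪ B)) := by
      constructor
      · refine ((hA.1.union hB.1).biUnion (fun τ _ => finite_prefixes τ.node)).subset ?_
        intro n hn
        simp only [Set.mem_iUnion]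
        rcases hne n hn with ⟨τ, hτ, rfl⟩ | ⟨τ, hτ, h⟩
        · exact ⟨τ, hτ, List.prefix_refl _⟩
        · exact ⟨τ, hτ, h.1⟩
      · have : ∀ (k : ℕ) (n m : Node N), n.1.length = k → Anc m n →
            witness (A ∪ B) n ≠ Val.empty → witness (A ∪ B) m = Val.dir := by
          intro k
          induction k with
          | zero =>
            intro n m hn
            exact absurd (List.length_eq_zero_iff.1 hn) n.2
          | succ k ih =>
            intro n m hn hanc hw
            obtain ⟨p, hp, hmp⟩ := anc_parent hanc
            have hd := step n p hp hw
            have hlen := hp.len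
            rcases hmp with rfl | hmp
            · exact hd
            · exact ih p m (by omega) hmp (by simp [hd])
        exact fun n m => this _ n m rfl
    have up : ∀ τ ∈ A ∪ B, ∀ p, IsParent p τ.node →
        (∀ σ ∈ A ∪ B, σ.node = p → σ.inp = Val.dir) → witness (A ∪ B) p = Val.dir := by
      intro τ hτ p hp h
      by_cases hm : Mentions (A ∪ B) p
      · obtain ⟨σ, hσ, e⟩ := hm
        rw [← h σ hσ e, ← w1 σ hσ, e]
      · exact w2 p hm τ hτ hp.anc
    have down : ∀ σ ∈ A ∪ B, ∀ n, IsParent σ.node n →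
        (∀ τ ∈ A ∪ B, τ.node = n → τ.inp = Val.empty) → witness (A ∪ B) n = Val.empty := by
      intro σ hσ n hp h
      by_cases hm : Mentions (A ∪ B) n
      · obtain ⟨τ, hτ, e⟩ := hm
        rw [← h τ hτ e, ← w1 τ hτ, e]
      · exact w3 n hm (fun ⟨τ, hτ, h'⟩ => hm (hb σ hσ τ hτ n hp.anc h'))
    refine ⟨witness (A ∪ B), hv, (setNoBreak_iff hA hv).2 ⟨?_, ?_, ?_⟩,
      (setNoBreak_iff hB hv).2 ⟨?_, ?_, ?_⟩⟩
    · exact fun σ hσ => w1 σ (Or.inl hσ)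
    · intro τ hτ p hp hm
      refine up τ (Or.inl hτ) p hp ?_
      rintro σ hσ rfl
      exact (hc σ hσ τ (Or.inl hτ) hp).1 (Or.inl ⟨⟨τ, hτ, rfl⟩, hm⟩)
    · intro σ hσ n hp hm
      refine down σ (Or.inl hσ) n hp ?_
      rintro τ hτ rfl
      exact (hc σ (Or.inl hσ) τ hτ hp).2 (Or.inl ⟨⟨σ, hσ, rfl⟩, hm⟩)
    · exact fun σ hσ => w1 σ (Or.inr hσ)
    · intro τ hτ p hp hm
      refine up τ (Or.inr hτ) p hp ?_
      rintro σ hσ rfl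
      exact (hc σ hσ τ (Or.inr hτ) hp).1 (Or.inr ⟨⟨τ, hτ, rfl⟩, hm⟩)
    · intro σ hσ n hp hm
      refine down σ (Or.inr hσ) n hp ?_
      rintro τ hτ rfl
      exact (hc σ (Or.inr hσ) τ hτ hp).2 (Or.inr ⟨⟨σ, hσ, rfl⟩, hm⟩)

end FileSync
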